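/- arXiv:0905.0087 — 2 statements merged into one kernel-verified Lean document; each statement's English description precedes it below -/
import Mathlib

section
/- Let H be a commutative, connected, graded Hopf algebra over a field k of characteristic zero, and let α ∈ G(H) be a character of H. Then for all h ∈ H, log*(α)(h) = α(e(h)), where e is the Eulerian idempotent; that is, the convolution logarithm on characters is given by right composition with the Eulerian idempotent, and in particular log* maps G(H) into the infinitesimal characters g(H). -/
open TensorProduct

noncomputable section

/-- The convolution product on `End_k(H)`. -/
def convE {k H : Type} [Field k] [CommRing H] [Bialgebra k H]
    (f g : H →ₗ[k] H) : H →ₗ[k] H :=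
  (LinearMap.mul' k H) ∘ₗ (TensorProduct.map f g) ∘ₗ (Coalgebra.comul (R := k))

/-- The convolution unit `δ = η ∘ ε` on `End_k(H)`. -/
def convUnitE (k H : Type) [Field k] [CommRing H] [Bialgebra k H] : H →ₗ[k] H :=
  (Algebra.linearMap k H) ∘ₗ (Coalgebra.counit (R := k))

/-- Convolution powers in `End_k(H)`, with `f^{*0} = δ`. -/
def convEPow {k H : Type} [Field k] [CommRing H] [Bialgebra k H]
    (f : H →ₗ[k] H) : ℕ → (H →ₗ[k] H)
  | 0 => convUnitE k H
  | n + 1 => convE f (convEPow f n)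

/-- The convolution product on `k`-valued linear maps. -/
def convK {k H : Type} [Field k] [CommRing H] [Bialgebra k H]
    (f g : H →ₗ[k] k) : H →ₗ[k] k :=
  (LinearMap.mul' k k) ∘ₗ (TensorProduct.map f g) ∘ₗ (Coalgebra.comul (R := k))

/-- Convolution powers of `k`-valued maps, with `f^{*0} = δ = ε`. -/
def convKPow {k H : Type} [Field k] [CommRing H] [Bialgebra k H]
    (f : H →ₗ[k] k) : ℕ → (H →ₗ[k] k)
  | 0 => Coalgebra.counit (R := k)
  | n + 1 => convK f (convKPow f n)

/-- A character: a unital algebra morphism `H → k`. -/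
def IsChar {k H : Type} [Field k] [CommRing H] [Bialgebra k H]
    (f : H →ₗ[k] k) : Prop :=
  f 1 = 1 ∧ ∀ x y : H, f (x * y) = f x * f y

/-- An infinitesimal character: `f(xy) = f(x)ε(y) + ε(x)f(y)`. -/
def IsInfChar {k H : Type} [Field k] [CommRing H] [Bialgebra k H]
    (f : H →ₗ[k] k) : Prop :=
  ∀ x y : H, f (x * y) = f x * Coalgebra.counit (R := k) y
    + Coalgebra.counit (R := k) x * f y

section Powers

open WithConv

variable {k H : Type} [Field k] [CommRing H] [Bialgebra k H]

lemma toConv_convKPow (f : H →ₗ[k] k) (n : ℕ) :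
    toConv (convKPow f n) = toConv f ^ n := by
  induction n with
  | zero => rfl
  | succ n ih => rw [pow_succ', ← ih]; rfl

lemma IsChar.comp_convEPow {α : H →ₗ[k] k} (hα : IsChar α) (f : H →ₗ[k] H) (n : ℕ) :
    α ∘ₗ convEPow f n = convKPow (α ∘ₗ f) n := by
  induction n with
  | zero =>
    ext x
    simp [convEPow, convUnitE, convKPow, Algebra.algebraMap_eq_smul_one, hα.1]
  | succ n ih =>
    have hmul : α ∘ₗ LinearMap.mul' k H = LinearMap.mul' k k ∘ₗ TensorProduct.map α α := by
      ext x y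
      simp [hα.2]
    rw [convEPow, convKPow, ← ih, convE, convK, TensorProduct.map_comp, ← LinearMap.comp_assoc,
      hmul]
    simp only [LinearMap.comp_assoc]

lemma IsChar.comp_id_sub_convUnitE {α : H →ₗ[k] k} (hα : IsChar α) :
    α ∘ₗ (LinearMap.id - convUnitE k H) = α - Coalgebra.counit (R := k) := by
  ext x
  simp [convUnitE, Algebra.algebraMap_eq_smul_one, hα.1]

lemma IsChar.isChar_convKPow {α : H →ₗ[k] k} (hα : IsChar α) (n : ℕ) : IsChar (convKPow α n) := by
  let a : H →ₐ[k] k := AlgHom.ofLinearMap α hα.1 hα.2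
  have h := AlgHom.toLinearMap_convPow (toConv a) n
  have ha : toConv (toConv a).ofConv.toLinearMap = toConv α := rfl
  rw [ha, ← toConv_convKPow] at h
  rw [← toConv_injective h]
  exact ⟨map_one (toConv a ^ n).ofConv, map_mul (toConv a ^ n).ofConv⟩

/-- Binomial expansion of the convolution powers of `f` around the unit. -/
lemma convKPow_eq_sum_choose (f : H →ₗ[k] k) (m : ℕ) (x : H) :
    convKPow f m x = ∑ i ∈ Finset.range (m + 1),
      (m.choose i : k) * convKPow (f - Coalgebra.counit (R := k)) i x := by
  have h1 : toConv f = toConv (f - Coalgebra.counit (R := k)) + 1 :=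
    (sub_add_cancel (toConv f) (toConv (Coalgebra.counit (R := k)))).symm
  have h : toConv (convKPow f m) = toConv (∑ i ∈ Finset.range (m + 1),
      (m.choose i) • convKPow (f - Coalgebra.counit (R := k)) i) := by
    rw [toConv_convKPow, h1, (Commute.one_right _).add_pow, toConv_sum]
    refine Finset.sum_congr rfl fun i _ => ?_
    rw [one_pow, mul_one, ← nsmul_eq_mul', ← toConv_convKPow]
    rfl
  rw [toConv_injective h]
  simp

end Powers

section Graded

variable {k H : Type} [Field k] [CommRing H] [Bialgebra k H]

/-- In a connected grading, the convolution powers of a map vanishing at `1` are locally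
nilpotent. -/
lemma convKPow_eq_zero_of_lt (ℋ : ℕ → Submodule k H)
    (hcomul : ∀ n : ℕ, ∀ x ∈ ℋ n,
      Coalgebra.comul (R := k) x ∈
        ⨆ (pq : ℕ × ℕ) (_ : pq.1 + pq.2 = n),
          LinearMap.range (TensorProduct.mapIncl (ℋ pq.1) (ℋ pq.2)))
    (hconn : ℋ 0 = Submodule.span k {(1 : H)})
    {f : H →ₗ[k] k} (hf : f 1 = 0) {i n : ℕ} (hin : n < i) {x : H} (hx : x ∈ ℋ n) :
    convKPow f i x = 0 := by
  induction i generalizing n x with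
  | zero => omega
  | succ i ih =>
    suffices h : (⨆ (pq : ℕ × ℕ) (_ : pq.1 + pq.2 = n),
        LinearMap.range (TensorProduct.mapIncl (ℋ pq.1) (ℋ pq.2))) ≤
        LinearMap.ker (LinearMap.mul' k k ∘ₗ TensorProduct.map f (convKPow f i)) from
      h (hcomul n x hx)
    refine iSup₂_le fun pq hpq => ?_
    rw [LinearMap.range_le_ker_iff]
    ext ⟨y, hy⟩ ⟨z, hz⟩
    obtain ⟨p, q⟩ := pq
    simp only at hpq hy hz
    suffices f y * convKPow f i z = 0 by simpa [TensorProduct.mapIncl] using this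
    rcases Nat.eq_zero_or_pos p with rfl | hp
    · rw [hconn] at hy
      obtain ⟨c, rfl⟩ := Submodule.mem_span_singleton.1 hy
      simp [hf]
    · rw [ih (by omega) hz, mul_zero]

end Graded

section BinomialPolynomial

open Polynomial

variable {k : Type} [Field k]

/-- The polynomial `∑_{i ≤ n} aᵢ (X choose i)`. -/
def binomialPoly (a : ℕ → k) (n : ℕ) : k[X] :=
  ∑ i ∈ Finset.range (n + 1), C (a i / (i.factorial : k)) * descPochhammer k i

lemma binomialPoly_eval_natCast [CharZero k] (a : ℕ → k) (n m : ℕ) :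
    (binomialPoly a n).eval (m : k) = ∑ i ∈ Finset.range (n + 1), (m.choose i : k) * a i := by
  rw [binomialPoly, eval_finsetSum]
  refine Finset.sum_congr rfl fun i _ => ?_
  rw [eval_mul, eval_C, Nat.cast_choose_eq_descPochhammer_div]
  ring

lemma binomialPoly_coeff_zero (a : ℕ → k) (n : ℕ) : (binomialPoly a n).coeff 0 = a 0 := by
  rw [coeff_zero_eq_eval_zero, binomialPoly, eval_finsetSum, Finset.sum_range_succ']
  simp [descPochhammer_ne_zero_eval_zero]

lemma descPochhammer_eval_neg_one (n : ℕ) :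
    (descPochhammer k n).eval (-1) = (-1) ^ n * (n.factorial : k) := by
  induction n with
  | zero => simp
  | succ n ih =>
    rw [descPochhammer_succ_eval, ih, Nat.factorial_succ]
    push_cast
    ring

lemma binomialPoly_coeff_one [CharZero k] (a : ℕ → k) (n : ℕ) :
    (binomialPoly a n).coeff 1 =
      ∑ i ∈ Finset.Icc 1 n, (((-1 : k) ^ (i + 1)) * (i : k)⁻¹) * a i := by
  rw [binomialPoly, finsetSum_coeff, Finset.sum_range_succ', Finset.range_eq_Ico,
    Finset.sum_Ico_add' (fun i => (C (a i / (i.factorial : k)) * descPochhammer k i).coeff 1)]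
  simp only [descPochhammer_zero, mul_one, coeff_C_succ, add_zero]
  refine Finset.sum_congr (by ext; simp) fun i hi => ?_
  obtain ⟨j, rfl⟩ := Nat.exists_eq_add_of_le' (Finset.mem_Icc.1 hi).1
  have hj : ((j.factorial : ℕ) : k) ≠ 0 := Nat.cast_ne_zero.2 j.factorial_ne_zero
  have hj' : (j : k) + 1 ≠ 0 := Nat.cast_add_one_ne_zero j
  rw [coeff_C_mul, descPochhammer_succ_left, coeff_X_mul, coeff_zero_eq_eval_zero, eval_comp]
  simp only [eval_sub, eval_X, eval_one, zero_sub, descPochhammer_eval_neg_one,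
    Nat.factorial_succ]
  push_cast
  field_simp
  ring

end BinomialPolynomial

section Character

open Polynomial

variable {k H : Type} [Field k] [CharZero k] [CommRing H] [Bialgebra k H]

/-- On a homogeneous element of degree `n`, the `m`-th convolution power of a character is
polynomial in `m`. -/
lemma IsChar.convKPow_eq_eval_binomialPoly (ℋ : ℕ → Submodule k H)
    (hcomul : ∀ n : ℕ, ∀ x ∈ ℋ n,
      Coalgebra.comul (R := k) x ∈
        ⨆ (pq : ℕ × ℕ) (_ : pq.1 + pq.2 = n),
          LinearMap.range (TensorProduct.mapIncl (ℋ pq.1) (ℋ pq.2)))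
    (hconn : ℋ 0 = Submodule.span k {(1 : H)})
    {α : H →ₗ[k] k} (hα : IsChar α) {n : ℕ} {x : H} (hx : x ∈ ℋ n) (m : ℕ) :
    convKPow α m x =
      (binomialPoly (fun i => convKPow (α - Coalgebra.counit (R := k)) i x) n).eval (m : k) := by
  have h1 : (α - Coalgebra.counit (R := k) : H →ₗ[k] k) 1 = 0 := by simp [hα.1]
  rw [convKPow_eq_sum_choose, binomialPoly_eval_natCast]
  rcases le_total m n with h | h
  · refine Finset.sum_subset (Finset.range_mono (by omega)) fun i _ hi => ?_
    rw [Nat.choose_eq_zero_of_lt (by simpa using hi), Nat.cast_zero, zero_mul]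
  · refine (Finset.sum_subset (Finset.range_mono (by omega)) fun i _ hi => ?_).symm
    rw [convKPow_eq_zero_of_lt ℋ hcomul hconn h1 (by simpa using hi) hx, mul_zero]

end Character

/-- Let `H` be a commutative, connected, graded Hopf algebra over a field
`k` of characteristic zero and `α ∈ G(H)` a character.  Then `log*(α)(h) = α(e(h))` for all
`h ∈ H`, where `e` is the Eulerian idempotent; in particular `log*(α)` is an infinitesimal
character. -/
theorem log_of_character_eq_comp_eulerian_idempotent
    {k H : Type} [Field k] [CharZero k] [CommRing H] [HopfAlgebra k H]
    (ℋ : ℕ → Submodule k H) [DirectSum.Decomposition ℋ]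
    (hmul : ∀ p q : ℕ, ∀ x ∈ ℋ p, ∀ y ∈ ℋ q, x * y ∈ ℋ (p + q))
    (hcomul : ∀ n : ℕ, ∀ x ∈ ℋ n,
      Coalgebra.comul (R := k) x ∈
        ⨆ (pq : ℕ × ℕ) (_ : pq.1 + pq.2 = n),
          LinearMap.range (TensorProduct.mapIncl (ℋ pq.1) (ℋ pq.2)))
    (hconn : ℋ 0 = Submodule.span k {(1 : H)})
    -- the Eulerian idempotent `e = log*(Id)`
    (e : H →ₗ[k] H)
    (he : ∀ n : ℕ, ∀ x ∈ ℋ n,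
      e x = ∑ i ∈ Finset.Icc 1 n,
        (((-1 : k) ^ (i + 1)) * (i : k)⁻¹) •
          convEPow (LinearMap.id - convUnitE k H) i x)
    -- a character `α` and its convolution logarithm `L = log*(α)`
    (α : H →ₗ[k] k) (hα : IsChar α)
    (L : H →ₗ[k] k)
    (hL : ∀ n : ℕ, ∀ x ∈ ℋ n,
      L x = ∑ i ∈ Finset.Icc 1 n,
        (((-1 : k) ^ (i + 1)) * (i : k)⁻¹) •
          convKPow (α - Coalgebra.counit (R := k)) i x) :
    (∀ h : H, L h = α (e h)) ∧ IsInfChar L := by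
  constructor
  · intro h
    induction h using DirectSum.Decomposition.inductionOn ℋ with
    | zero => simp
    | @homogeneous n x =>
      rw [hL n x x.2, he n x x.2, map_sum]
      refine Finset.sum_congr rfl fun i _ => ?_
      rw [map_smul, ← hα.comp_id_sub_convUnitE, ← hα.comp_convEPow, LinearMap.comp_apply]
    | add x y hx hy => rw [map_add, map_add, map_add, hx, hy]
  · have key : ∀ p q : ℕ, ∀ x ∈ ℋ p, ∀ y ∈ ℋ q,
        L (x * y) = L x * Coalgebra.counit (R := k) y + Coalgebra.counit (R := k) x * L y := by
      intro p q x hx y hy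
      let P (z : H) (n : ℕ) : Polynomial k :=
        binomialPoly (fun i => convKPow (α - Coalgebra.counit (R := k)) i z) n
      have hP : P (x * y) (p + q) = P x p * P y q := by
        refine Polynomial.eq_of_infinite_eval_eq _ _
          ((Set.infinite_range_of_injective (Nat.cast_injective (R := k))).mono ?_)
        rintro _ ⟨m, rfl⟩
        simp only [Set.mem_ofPred_eq, Polynomial.eval_mul, P]
        rw [← hα.convKPow_eq_eval_binomialPoly ℋ hcomul hconn (hmul p q x hx y hy),
          ← hα.convKPow_eq_eval_binomialPoly ℋ hcomul hconn hx,
          ← hα.convKPow_eq_eval_binomialPoly ℋ hcomul hconn hy, (hα.isChar_convKPow m).2]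
      have hP0 (z : H) (n : ℕ) : (P z n).coeff 0 = Coalgebra.counit (R := k) z :=
        binomialPoly_coeff_zero _ _
      have hP1 (z : H) (n : ℕ) (hz : z ∈ ℋ n) : (P z n).coeff 1 = L z := by
        rw [hL n z hz]
        exact binomialPoly_coeff_one _ _
      rw [← hP1 _ _ (hmul p q x hx y hy), hP, Polynomial.mul_coeff_one, hP0, hP0, hP1 x p hx,
        hP1 y q hy]
      ring
    intro x y
    induction x using DirectSum.Decomposition.inductionOn ℋ with
    | zero => simp
    | @homogeneous p x =>
      induction y using DirectSum.Decomposition.inductionOn ℋ with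
      | zero => simp
      | @homogeneous q y => exact key p q x x.2 y y.2
      | add y z hy hz => simp only [mul_add, map_add, hy, hz]; ring
    | add x z hx hz => simp only [add_mul, map_add, hx, hz]; ring

end
end

section
/- Let H be a graded, commutative, connected Hopf algebra over a field k of characteristic zero, with grading operator Y and Dynkin operator D = S * Y. Then right composition with D, α ↦ α ∘ D, is a bijection from the group of characters G(H) onto the set of infinitesimal characters g(H), with inverse Γ : g(H) → G(H) given by Γ(α) = Σ_n Σ_{k_1+⋯+k_l=n, k_i>0} (α_{k_1} * ⋯ * α_{k_l}) / (k_1(k_1+k_2)⋯(k_1+⋯+k_l)), where α_k denotes the restriction of α to H_k (extended by zero). -/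
open TensorProduct

noncomputable section

/-- Iterated convolution `f₁ * f₂ * ⋯ * f_l` of a list of `k`-valued maps
(the empty convolution being the unit `δ = ε`). -/
def convList {k H : Type} [Field k] [CommRing H] [Bialgebra k H]
    (l : List (H →ₗ[k] k)) : H →ₗ[k] k :=
  l.foldr convK (Coalgebra.counit (R := k))

/-- The projection of `H` onto its graded piece `ℋ j`. -/
def gradedProj {k H : Type} [Field k] [AddCommGroup H] [Module k H]
    (ℋ : ℕ → Submodule k H) [DirectSum.Decomposition ℋ] (j : ℕ) : H →ₗ[k] H :=
  (ℋ j).subtype ∘ₗ (DirectSum.component k ℕ (fun i => ↥(ℋ i)) j) ∘ₗ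
    (DirectSum.decomposeLinearEquiv ℋ).toLinearMap

/-- The product of the partial sums `k₁(k₁+k₂)⋯(k₁+⋯+k_l)` of a list. -/
def partialSumsProd (l : List ℕ) : ℕ :=
  ((List.range l.length).map (fun i => (l.take (i + 1)).sum)).prod

/-- The map `Γ` of Ebrahimi-Fard, Gracia-Bondía and Patras, evaluated on the graded
piece `ℋ n`:  `Γ(α) = ∑ₙ ∑_{k₁+⋯+k_l = n} (α_{k₁} * ⋯ * α_{k_l}) / (k₁(k₁+k₂)⋯(k₁+⋯+k_l))`. -/
def GammaFormula {k H : Type} [Field k] [CommRing H] [Bialgebra k H]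
    (ℋ : ℕ → Submodule k H) [DirectSum.Decomposition ℋ]
    (β : H →ₗ[k] k) (n : ℕ) (x : H) : k :=
  ∑ c : Composition n,
    ((partialSumsProd c.blocks : k))⁻¹ •
      convList (c.blocks.map (fun j => β ∘ₗ gradedProj ℋ j)) x

section Convolution

variable {k H : Type} [Field k] [CommRing H]

lemma convK_apply_repr [Bialgebra k H] (f g : H →ₗ[k] k) {x : H} {ι : Type*}
    (r : Coalgebra.Repr k x ι) :
    convK f g x = ∑ i ∈ r.index, f (r.left i) * g (r.right i) := by
  simp [convK, ← r.eq]

lemma convE_apply_repr [Bialgebra k H] (f g : H →ₗ[k] H) {x : H} {ι : Type*}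
    (r : Coalgebra.Repr k x ι) :
    convE f g x = ∑ i ∈ r.index, f (r.left i) * g (r.right i) := by
  simp [convE, ← r.eq]

lemma convK_eq_convMul [Bialgebra k H] (f g : H →ₗ[k] k) :
    convK f g = (WithConv.toConv f * WithConv.toConv g).ofConv := rfl

lemma convK_assoc [Bialgebra k H] (f g h : H →ₗ[k] k) :
    convK (convK f g) h = convK f (convK g h) := by
  simp only [convK_eq_convMul, WithConv.toConv_ofConv, mul_assoc]

lemma counit_convK [Bialgebra k H] (f : H →ₗ[k] k) :
    convK (Coalgebra.counit (R := k)) f = f :=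
  congrArg WithConv.ofConv (one_mul (WithConv.toConv f))

lemma convK_counit [Bialgebra k H] (f : H →ₗ[k] k) :
    convK f (Coalgebra.counit (R := k)) = f :=
  congrArg WithConv.ofConv (mul_one (WithConv.toConv f))

lemma convList_append_singleton [Bialgebra k H] (l : List (H →ₗ[k] k)) (f : H →ₗ[k] k) :
    convList (l ++ [f]) = convK (convList l) f := by
  induction l with
  | nil => simp [convList, counit_convK, convK_counit]
  | cons g l ih =>
    have ih' : convK g (convList (l ++ [f])) = convK g (convK (convList l) f) := by rw [ih]
    rw [← convK_assoc] at ih'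
    exact ih'

lemma convK_mul_repr [Bialgebra k H] (f g : H →ₗ[k] k) {x y : H} {ι κ : Type*}
    (r : Coalgebra.Repr k x ι) (s : Coalgebra.Repr k y κ) :
    convK f g (x * y) = ∑ i ∈ r.index, ∑ j ∈ s.index,
      f (r.left i * s.left j) * g (r.right i * s.right j) := by
  simp only [convK, LinearMap.comp_apply, Bialgebra.comul_mul, ← r.eq, ← s.eq,
    Finset.sum_mul_sum, Algebra.TensorProduct.tmul_mul_tmul, map_sum,
    TensorProduct.map_tmul, LinearMap.mul'_apply]

/-- Right convolution with an infinitesimal character is a derivation. -/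
lemma convK_mul_of_isInfChar [Bialgebra k H] (G : H →ₗ[k] k) {β : H →ₗ[k] k}
    (hβ : IsInfChar β) (x y : H) :
    convK G β (x * y) = convK (G ∘ₗ LinearMap.mulRight k y) β x +
      convK (G ∘ₗ LinearMap.mulLeft k x) β y := by
  let r := Coalgebra.Repr.arbitrary k x
  let s := Coalgebra.Repr.arbitrary k y
  have hx (z : H) : G (x * z) = ∑ i ∈ r.index,
      G (r.left i * z) * Coalgebra.counit (R := k) (r.right i) := by
    rw [← LinearMap.mulRight_apply k z x, ← LinearMap.comp_apply,
      ← convK_counit (G ∘ₗ LinearMap.mulRight k z), convK_apply_repr _ _ r]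
    simp
  have hy (z : H) : G (z * y) = ∑ j ∈ s.index,
      G (z * s.left j) * Coalgebra.counit (R := k) (s.right j) := by
    rw [← LinearMap.mulLeft_apply k z y, ← LinearMap.comp_apply,
      ← convK_counit (G ∘ₗ LinearMap.mulLeft k z), convK_apply_repr _ _ s]
    simp
  rw [convK_mul_repr G β r s, convK_apply_repr _ _ r, convK_apply_repr _ _ s]
  simp only [LinearMap.comp_apply, LinearMap.mulRight_apply, LinearMap.mulLeft_apply, hx, hy,
    hβ _ _, mul_add, Finset.sum_add_distrib, Finset.sum_mul]
  congr 1
  · refine Finset.sum_congr rfl fun i _ => Finset.sum_congr rfl fun j _ => by ring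
  · rw [Finset.sum_comm]
    refine Finset.sum_congr rfl fun i _ => Finset.sum_congr rfl fun j _ => by ring

lemma IsInfChar.map_one [Bialgebra k H] {β : H →ₗ[k] k} (hβ : IsInfChar β) : β 1 = 0 := by
  simpa using hβ 1 1

lemma IsChar.comp_convE [Bialgebra k H] {α : H →ₗ[k] k} (hα : IsChar α) (f g : H →ₗ[k] H) :
    α ∘ₗ convE f g = convK (α ∘ₗ f) (α ∘ₗ g) := by
  ext x
  let r := Coalgebra.Repr.arbitrary k x
  simp [convK_apply_repr _ _ r, convE_apply_repr _ _ r, hα.2]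

lemma IsChar.convK_comp_antipode [HopfAlgebra k H] {α : H →ₗ[k] k} (hα : IsChar α) :
    convK α (α ∘ₗ HopfAlgebra.antipode k) = Coalgebra.counit (R := k) := by
  ext x
  let r := Coalgebra.Repr.arbitrary k x
  have h := congrArg α (HopfAlgebra.sum_mul_antipode_eq_smul r)
  simpa [convK_apply_repr _ _ r, hα.1, hα.2] using h

lemma IsChar.comp_antipode_convK [HopfAlgebra k H] {α : H →ₗ[k] k} (hα : IsChar α) :
    convK (α ∘ₗ HopfAlgebra.antipode k) α = Coalgebra.counit (R := k) := by
  ext x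
  let r := Coalgebra.Repr.arbitrary k x
  have h := congrArg α (HopfAlgebra.sum_antipode_mul_eq_smul r)
  simpa [convK_apply_repr _ _ r, hα.1, hα.2] using h

/-- A character turns the Dynkin operator of a derivation into an infinitesimal character. -/
lemma IsChar.isInfChar_comp_convE_antipode [HopfAlgebra k H] {α : H →ₗ[k] k} (hα : IsChar α)
    {Y : H →ₗ[k] H} (hY : ∀ x y, Y (x * y) = Y x * y + x * Y y) :
    IsInfChar (α ∘ₗ convE (HopfAlgebra.antipode k) Y) := by
  intro x y
  let r := Coalgebra.Repr.arbitrary k x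
  let s := Coalgebra.Repr.arbitrary k y
  rw [hα.comp_convE, ← hα.comp_antipode_convK, convK_mul_repr _ _ r s]
  simp only [convK_apply_repr _ _ r, convK_apply_repr _ _ s, Finset.sum_mul_sum,
    ← Finset.sum_add_distrib]
  refine Finset.sum_congr rfl fun i _ => Finset.sum_congr rfl fun j _ => ?_
  simp only [LinearMap.comp_apply, HopfAlgebra.antipode_mul_distrib, hα.2, hY, map_add]
  ring

end Convolution

section Graded

variable {k H : Type} [Field k] [CommRing H] [Bialgebra k H]
  (ℋ : ℕ → Submodule k H)

lemma gradedProj_of_mem [DirectSum.Decomposition ℋ] {q : ℕ} {x : H} (hx : x ∈ ℋ q) (j : ℕ) :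
    gradedProj ℋ j x = if q = j then x else 0 := by
  change ((DirectSum.decompose ℋ x j : ℋ j) : H) = _
  split_ifs with h
  · subst h
    exact DirectSum.decompose_of_mem_same ℋ hx
  · exact DirectSum.decompose_of_mem_ne ℋ hx h

lemma linearMap_ext_of_homogeneous {M : Type*} [AddCommGroup M] [Module k M]
    [DirectSum.Decomposition ℋ] {f g : H →ₗ[k] M} (h : ∀ n, ∀ x ∈ ℋ n, f x = g x) : f = g := by
  ext x
  induction x using DirectSum.Decomposition.inductionOn ℋ with
  | zero => simp
  | homogeneous m => exact h _ _ m.2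
  | add x y hx hy => simp [hx, hy]

/-- On a homogeneous tensor it suffices to compare linear maps on tensors of homogeneous
elements. -/
lemma eq_of_mem_iSup_range_mapIncl {M : Type*} [AddCommGroup M] [Module k M] {n : ℕ}
    {t : H ⊗[k] H}
    (ht : t ∈ ⨆ (pq : ℕ × ℕ) (_ : pq.1 + pq.2 = n),
      LinearMap.range (TensorProduct.mapIncl (ℋ pq.1) (ℋ pq.2)))
    {φ ψ : H ⊗[k] H →ₗ[k] M}
    (h : ∀ p q, p + q = n → ∀ a ∈ ℋ p, ∀ b ∈ ℋ q, φ (a ⊗ₜ b) = ψ (a ⊗ₜ b)) :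
    φ t = ψ t := by
  suffices hle : (⨆ (pq : ℕ × ℕ) (_ : pq.1 + pq.2 = n),
      LinearMap.range (TensorProduct.mapIncl (ℋ pq.1) (ℋ pq.2))) ≤ LinearMap.eqLocus φ ψ from
    hle ht
  refine iSup₂_le fun pq hpq => ?_
  rintro _ ⟨u, rfl⟩
  have hcomp : φ ∘ₗ TensorProduct.mapIncl (ℋ pq.1) (ℋ pq.2) =
      ψ ∘ₗ TensorProduct.mapIncl (ℋ pq.1) (ℋ pq.2) :=
    TensorProduct.ext' fun a b => by
      simpa [TensorProduct.mapIncl] using h _ _ hpq a a.2 b b.2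
  exact LinearMap.congr_fun hcomp u

lemma eqOn_degree_zero {M : Type*} [AddCommGroup M] [Module k M]
    (hconn : ℋ 0 = Submodule.span k {(1 : H)}) {f g : H →ₗ[k] M} (h : f 1 = g 1)
    {x : H} (hx : x ∈ ℋ 0) : f x = g x := by
  rw [hconn, Submodule.mem_span_singleton] at hx
  obtain ⟨c, rfl⟩ := hx
  simp [h]

lemma grading_derivation [DirectSum.Decomposition ℋ]
    (hmul : ∀ p q : ℕ, ∀ x ∈ ℋ p, ∀ y ∈ ℋ q, x * y ∈ ℋ (p + q))
    {Y : H →ₗ[k] H} (hY : ∀ n : ℕ, ∀ x ∈ ℋ n, Y x = (n : k) • x) (x y : H) :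
    Y (x * y) = Y x * y + x * Y y := by
  induction x using DirectSum.Decomposition.inductionOn ℋ with
  | zero => simp
  | add a b ha hb => simp only [add_mul, map_add, ha, hb]; ring
  | homogeneous a =>
    induction y using DirectSum.Decomposition.inductionOn ℋ with
    | zero => simp
    | add b c hb hc => simp only [mul_add, map_add, hb, hc]; ring
    | homogeneous b =>
      rw [hY _ _ (hmul _ _ _ a.2 _ b.2), hY _ _ a.2, hY _ _ b.2]
      simp [add_smul]

lemma convK_congr_of_homogeneous
    (hcomul : ∀ n : ℕ, ∀ x ∈ ℋ n,
      Coalgebra.comul (R := k) x ∈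
        ⨆ (pq : ℕ × ℕ) (_ : pq.1 + pq.2 = n),
          LinearMap.range (TensorProduct.mapIncl (ℋ pq.1) (ℋ pq.2)))
    {f g f' g' : H →ₗ[k] k} {n : ℕ} {x : H} (hx : x ∈ ℋ n)
    (h : ∀ p q, p + q = n → ∀ a ∈ ℋ p, ∀ b ∈ ℋ q, f a * g b = f' a * g' b) :
    convK f g x = convK f' g' x := by
  refine eq_of_mem_iSup_range_mapIncl ℋ (hcomul n x hx)
    (φ := LinearMap.mul' k k ∘ₗ TensorProduct.map f g)
    (ψ := LinearMap.mul' k k ∘ₗ TensorProduct.map f' g') fun p q hpq a ha b hb => ?_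
  simpa using h p q hpq a ha b hb

/-- A linear form solving `G ∘ Y = G * β` with `G 1 = 1`, for an infinitesimal character `β`,
is a character. -/
lemma isChar_of_natCast_mul_eq_convK [CharZero k] [DirectSum.Decomposition ℋ]
    (hmul : ∀ p q : ℕ, ∀ x ∈ ℋ p, ∀ y ∈ ℋ q, x * y ∈ ℋ (p + q))
    (hcomul : ∀ n : ℕ, ∀ x ∈ ℋ n,
      Coalgebra.comul (R := k) x ∈
        ⨆ (pq : ℕ × ℕ) (_ : pq.1 + pq.2 = n),
          LinearMap.range (TensorProduct.mapIncl (ℋ pq.1) (ℋ pq.2)))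
    (hconn : ℋ 0 = Submodule.span k {(1 : H)})
    {β G : H →ₗ[k] k} (hβ : IsInfChar β) (hG1 : G 1 = 1)
    (hG : ∀ n : ℕ, ∀ x ∈ ℋ n, (n : k) * G x = convK G β x) : IsChar G := by
  have hβ0 : ∀ b ∈ ℋ 0, β b = 0 := fun b hb =>
    eqOn_degree_zero ℋ hconn (f := β) (g := 0) (by simpa using hβ.map_one) hb
  have key : ∀ n p q, p + q = n → ∀ x ∈ ℋ p, ∀ y ∈ ℋ q, G (x * y) = G x * G y := by
    intro n
    induction n using Nat.strong_induction_on with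
    | _ n ih =>
    intro p q hpq x hx y hy
    rcases Nat.eq_zero_or_pos n with rfl | hn
    · obtain ⟨rfl, rfl⟩ : p = 0 ∧ q = 0 := by omega
      exact eqOn_degree_zero ℋ hconn (f := G ∘ₗ LinearMap.mulRight k y) (g := G y • G)
        (by simp [hG1]) hx |>.trans (by simp [mul_comm])
    · have h1 : convK (G ∘ₗ LinearMap.mulRight k y) β x = convK (G y • G) β x := by
        refine convK_congr_of_homogeneous ℋ hcomul hx fun i j hij a ha b hb => ?_
        rcases Nat.eq_zero_or_pos j with rfl | hj
        · simp [hβ0 b hb]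
        · simp [ih (i + q) (by omega) i q rfl a ha y hy, mul_comm (G a)]
      have h2 : convK (G ∘ₗ LinearMap.mulLeft k x) β y = convK (G x • G) β y := by
        refine convK_congr_of_homogeneous ℋ hcomul hy fun i j hij a ha b hb => ?_
        rcases Nat.eq_zero_or_pos j with rfl | hj
        · simp [hβ0 b hb]
        · simp [ih (p + i) (by omega) p i rfl x hx a ha]
      have hsmul (c : k) (z : H) : convK (c • G) β z = c * convK G β z := by
        simp [convK, TensorProduct.map_smul_left]
      have h3 := hG _ _ (hmul p q x hx y hy)
      rw [convK_mul_of_isInfChar G hβ, h1, h2, hsmul, hsmul, ← hG _ _ hx, ← hG _ _ hy] at h3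
      have hne : ((p + q : ℕ) : k) ≠ 0 := by
        rw [hpq]; exact_mod_cast hn.ne'
      apply mul_left_cancel₀ hne
      rw [h3]
      push_cast
      ring
  refine ⟨hG1, fun x y => ?_⟩
  induction x using DirectSum.Decomposition.inductionOn ℋ with
  | zero => simp
  | add a b ha hb => simp only [add_mul, map_add, ha, hb]
  | homogeneous a =>
    induction y using DirectSum.Decomposition.inductionOn ℋ with
    | zero => simp
    | add b c hb hc => simp only [mul_add, map_add, hb, hc]
    | homogeneous b => exact key _ _ _ rfl _ a.2 _ b.2

/-- The equation `G ∘ Y = G * β` has at most one solution with a prescribed value at `1`. -/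
lemma eq_of_natCast_mul_eq_convK [CharZero k] [DirectSum.Decomposition ℋ]
    (hcomul : ∀ n : ℕ, ∀ x ∈ ℋ n,
      Coalgebra.comul (R := k) x ∈
        ⨆ (pq : ℕ × ℕ) (_ : pq.1 + pq.2 = n),
          LinearMap.range (TensorProduct.mapIncl (ℋ pq.1) (ℋ pq.2)))
    (hconn : ℋ 0 = Submodule.span k {(1 : H)})
    {β F G : H →ₗ[k] k} (hβ1 : β 1 = 0) (h1 : F 1 = G 1)
    (hF : ∀ n : ℕ, ∀ x ∈ ℋ n, (n : k) * F x = convK F β x)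
    (hG : ∀ n : ℕ, ∀ x ∈ ℋ n, (n : k) * G x = convK G β x) : F = G := by
  have hβ0 : ∀ b ∈ ℋ 0, β b = 0 := fun b hb =>
    eqOn_degree_zero ℋ hconn (f := β) (g := 0) (by simpa using hβ1) hb
  refine linearMap_ext_of_homogeneous ℋ fun n => ?_
  induction n using Nat.strong_induction_on with
  | _ n ih =>
  intro x hx
  rcases Nat.eq_zero_or_pos n with rfl | hn
  · exact eqOn_degree_zero ℋ hconn h1 hx
  · apply mul_left_cancel₀ (Nat.cast_ne_zero.mpr hn.ne' : (n : k) ≠ 0)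
    rw [hF n x hx, hG n x hx]
    refine convK_congr_of_homogeneous ℋ hcomul hx fun i j hij a ha b hb => ?_
    rcases Nat.eq_zero_or_pos j with rfl | hj
    · simp [hβ0 b hb]
    · rw [ih i (by omega) a ha]

end Graded

section Gamma

lemma partialSumsProd_append_singleton (l : List ℕ) (j : ℕ) :
    partialSumsProd (l ++ [j]) = partialSumsProd l * (l.sum + j) := by
  unfold partialSumsProd
  rw [List.length_append, List.length_singleton, List.range_succ, List.map_append,
    List.prod_append]
  congr 1
  · congr 1
    refine List.map_congr_left fun i hi => ?_
    rw [List.take_append_of_le_length (List.mem_range.mp hi)]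
  · simp

/-- Sums over compositions of `n > 0`, split according to the last block. -/
lemma sum_composition_eq_sum_append_last {M : Type*} [AddCommMonoid M] {n : ℕ} (hn : 0 < n)
    (F : List ℕ → M) :
    ∑ c : Composition n, F c.blocks =
      ∑ j : Fin n, ∑ c : Composition j, F (c.blocks ++ [n - j]) := by
  rw [← Fintype.sum_sigma' (fun (j : Fin n) (c : Composition j) => F (c.blocks ++ [n - j]))]
  symm
  refine Fintype.sum_bijective
    (fun jc : (Σ j : Fin n, Composition j) => (⟨jc.2.blocks ++ [n - jc.1], ?_, ?_⟩ : Composition n))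
    ⟨?_, ?_⟩ _ _ fun _ => rfl
  · intro i hi
    have := jc.1.2
    rcases List.mem_append.mp hi with h | h
    · exact jc.2.blocks_pos h
    · rw [List.mem_singleton.mp h]; omega
  · have := jc.1.2
    rw [List.sum_append, jc.2.blocks_sum, List.sum_singleton]; omega
  · rintro ⟨j, c⟩ ⟨j', c'⟩ h
    have hb : c.blocks = c'.blocks := List.append_inj_left' (congrArg Composition.blocks h) rfl
    obtain rfl : j = j' := Fin.ext (by rw [← c.blocks_sum, ← c'.blocks_sum, hb])
    obtain rfl : c = c' := Composition.ext hb
    rfl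
  · intro c
    have hne : c.blocks ≠ [] := by
      intro h
      have := c.blocks_sum
      simp [h] at this
      omega
    have hsplit := List.dropLast_append_getLast hne
    have hpos : 0 < c.blocks.getLast hne := c.blocks_pos (List.getLast_mem hne)
    have hsum : c.blocks.dropLast.sum + c.blocks.getLast hne = n := by
      rw [← List.sum_singleton (x := c.blocks.getLast hne), ← List.sum_append, hsplit,
        c.blocks_sum]
    refine ⟨⟨⟨c.blocks.dropLast.sum, by omega⟩,
      ⟨c.blocks.dropLast, fun hi => c.blocks_pos (List.mem_of_mem_dropLast hi), rfl⟩⟩, ?_⟩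
    apply Composition.ext
    change c.blocks.dropLast ++ [n - c.blocks.dropLast.sum] = c.blocks
    rw [show n - c.blocks.dropLast.sum = c.blocks.getLast hne by omega, hsplit]

variable {k H : Type} [Field k] [CommRing H] [Bialgebra k H]
  (ℋ : ℕ → Submodule k H) [DirectSum.Decomposition ℋ]

/-- `GammaFormula` as a linear form. -/
def gammaLinear (β : H →ₗ[k] k) (n : ℕ) : H →ₗ[k] k :=
  ∑ c : Composition n, ((partialSumsProd c.blocks : k))⁻¹ •
    convList (c.blocks.map (fun j => β ∘ₗ gradedProj ℋ j))

lemma gammaLinear_apply (β : H →ₗ[k] k) (n : ℕ) (x : H) :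
    gammaLinear ℋ β n x = GammaFormula ℋ β n x := by
  simp [gammaLinear, GammaFormula]

lemma GammaFormula_zero (β : H →ₗ[k] k) (x : H) :
    GammaFormula ℋ β 0 x = Coalgebra.counit (R := k) x := by
  have hb (c : Composition 0) : c.blocks = [] := by
    refine List.eq_nil_iff_forall_not_mem.mpr fun i hi => ?_
    exact (c.blocks_pos hi).ne' (List.sum_eq_zero_iff.mp c.blocks_sum i hi)
  simp [GammaFormula, hb, partialSumsProd, convList, composition_card]

lemma natCast_mul_GammaFormula [CharZero k] (β : H →ₗ[k] k) {n : ℕ} (hn : 0 < n) (x : H) :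
    (n : k) * GammaFormula ℋ β n x =
      ∑ j : Fin n, convK (gammaLinear ℋ β j) (β ∘ₗ gradedProj ℋ (n - j)) x := by
  have hn' : (n : k) ≠ 0 := Nat.cast_ne_zero.mpr hn.ne'
  let r := Coalgebra.Repr.arbitrary k x
  rw [GammaFormula, sum_composition_eq_sum_append_last hn
    (fun l => ((partialSumsProd l : k))⁻¹ •
      convList (l.map (fun j => β ∘ₗ gradedProj ℋ j)) x), Finset.mul_sum]
  refine Finset.sum_congr rfl fun j _ => ?_
  have hj : ((j : ℕ) : k) + ((n - j : ℕ) : k) = n := by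
    rw [← Nat.cast_add]; congr 1; omega
  simp only [List.map_append, List.map_cons, List.map_nil, convList_append_singleton,
    partialSumsProd_append_singleton, Composition.blocks_sum, convK_apply_repr _ _ r,
    gammaLinear, LinearMap.sum_apply, LinearMap.smul_apply, Nat.cast_mul, Nat.cast_add, hj,
    Finset.sum_mul, Finset.mul_sum, smul_eq_mul]
  rw [Finset.sum_comm]
  refine Finset.sum_congr rfl fun i _ => Finset.sum_congr rfl fun c _ => ?_
  rw [mul_inv]
  field_simp

/-- The linear form given by `GammaFormula` solves `G ∘ Y = G * β`. -/
lemma natCast_mul_eq_convK_of_GammaFormula [CharZero k]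
    (hcomul : ∀ n : ℕ, ∀ x ∈ ℋ n,
      Coalgebra.comul (R := k) x ∈
        ⨆ (pq : ℕ × ℕ) (_ : pq.1 + pq.2 = n),
          LinearMap.range (TensorProduct.mapIncl (ℋ pq.1) (ℋ pq.2)))
    (hconn : ℋ 0 = Submodule.span k {(1 : H)})
    {β G : H →ₗ[k] k} (hβ1 : β 1 = 0)
    (hG : ∀ n : ℕ, ∀ x ∈ ℋ n, G x = GammaFormula ℋ β n x) (n : ℕ) (x : H) (hx : x ∈ ℋ n) :
    (n : k) * G x = convK G β x := by
  have hβ0 : ∀ b ∈ ℋ 0, β b = 0 := fun b hb =>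
    eqOn_degree_zero ℋ hconn (f := β) (g := 0) (by simpa using hβ1) hb
  rcases Nat.eq_zero_or_pos n with rfl | hn
  · rw [convK_congr_of_homogeneous ℋ hcomul hx (f' := 0) (g' := 0) fun p q hpq a ha b hb => ?_]
    · simp [convK]
    · obtain rfl : q = 0 := by omega
      simp [hβ0 b hb]
  rw [hG n x hx, natCast_mul_GammaFormula ℋ β hn]
  have h := eq_of_mem_iSup_range_mapIncl ℋ (hcomul n x hx)
    (φ := ∑ j : Fin n, LinearMap.mul' k k ∘ₗ
      TensorProduct.map (gammaLinear ℋ β j) (β ∘ₗ gradedProj ℋ (n - j)))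
    (ψ := LinearMap.mul' k k ∘ₗ TensorProduct.map G β) fun p q hpq a ha b hb => ?_
  · simpa [convK] using h
  simp only [LinearMap.sum_apply, LinearMap.comp_apply, TensorProduct.map_tmul,
    LinearMap.mul'_apply, gradedProj_of_mem ℋ hb]
  rcases Nat.eq_zero_or_pos q with rfl | hq
  · rw [hβ0 b hb, mul_zero]
    refine Finset.sum_eq_zero fun j _ => ?_
    rw [if_neg (by omega), map_zero, mul_zero]
  · rw [Finset.sum_eq_single (⟨p, by omega⟩ : Fin n), if_pos (by simp; omega),
      gammaLinear_apply, hG p a ha]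
    · intro j _ hj
      have : (j : ℕ) ≠ p := fun h => hj (Fin.ext h)
      rw [if_neg (by omega), map_zero, mul_zero]
    · simp

end Gamma

/-- Let `H` be a graded, commutative, connected Hopf algebra over a field
`k` of characteristic zero, with grading operator `Y` and Dynkin operator `D = S * Y`.
Then `α ↦ α ∘ D` is a bijection from `G(H)` onto `g(H)` with inverse `Γ`. -/
theorem dynkin_bijection_characters_infinitesimal
    {k H : Type} [Field k] [CharZero k] [CommRing H] [HopfAlgebra k H]
    (ℋ : ℕ → Submodule k H) [DirectSum.Decomposition ℋ]
    (hmul : ∀ p q : ℕ, ∀ x ∈ ℋ p, ∀ y ∈ ℋ q, x * y ∈ ℋ (p + q))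
    (hcomul : ∀ n : ℕ, ∀ x ∈ ℋ n,
      Coalgebra.comul (R := k) x ∈
        ⨆ (pq : ℕ × ℕ) (_ : pq.1 + pq.2 = n),
          LinearMap.range (TensorProduct.mapIncl (ℋ pq.1) (ℋ pq.2)))
    (hconn : ℋ 0 = Submodule.span k {(1 : H)})
    -- the grading operator `Y` and the Dynkin operator `D = S * Y`
    (Y : H →ₗ[k] H) (hY : ∀ n : ℕ, ∀ x ∈ ℋ n, Y x = (n : k) • x)
    (D : H →ₗ[k] H) (hD : D = convE (HopfAlgebra.antipode (R := k)) Y) :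
    -- right composition with `D` maps characters to infinitesimal characters
    (∀ α : H →ₗ[k] k, IsChar α → IsInfChar (α ∘ₗ D)) ∧
    -- `Γ` maps infinitesimal characters to characters and is a right inverse of `- ∘ D`
    (∀ β G : H →ₗ[k] k, IsInfChar β →
      (∀ n : ℕ, ∀ x ∈ ℋ n, G x = GammaFormula ℋ β n x) →
      IsChar G ∧ G ∘ₗ D = β) ∧
    -- `Γ` is a left inverse of `- ∘ D` on characters
    (∀ α G : H →ₗ[k] k, IsChar α →
      (∀ n : ℕ, ∀ x ∈ ℋ n, G x = GammaFormula ℋ (α ∘ₗ D) n x) →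
      G = α) := by
  subst hD
  have hder := grading_derivation ℋ hmul hY
  have hone : (1 : H) ∈ ℋ 0 := hconn ▸ Submodule.mem_span_singleton_self 1
  have hΓ1 (β G : H →ₗ[k] k) (hG : ∀ n : ℕ, ∀ x ∈ ℋ n, G x = GammaFormula ℋ β n x) :
      G 1 = 1 := by
    rw [hG 0 1 hone, GammaFormula_zero, Bialgebra.counit_one]
  refine ⟨fun α hα => hα.isInfChar_comp_convE_antipode hder, fun β G hβ hG => ?_,
    fun α G hα hG => ?_⟩
  · have hrec := natCast_mul_eq_convK_of_GammaFormula ℋ hcomul hconn hβ.map_one hG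
    have hchar := isChar_of_natCast_mul_eq_convK ℋ hmul hcomul hconn hβ (hΓ1 β G hG) hrec
    have hGY : G ∘ₗ Y = convK G β := linearMap_ext_of_homogeneous ℋ fun n x hx => by
      simp [hY n x hx, ← hrec n x hx]
    refine ⟨hchar, ?_⟩
    rw [hchar.comp_convE, hGY, ← convK_assoc, hchar.comp_antipode_convK, counit_convK]
  · have hβ := hα.isInfChar_comp_convE_antipode hder
    have hαY : convK α (α ∘ₗ convE (HopfAlgebra.antipode k) Y) = α ∘ₗ Y := by
      rw [hα.comp_convE, ← convK_assoc, hα.convK_comp_antipode, counit_convK]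
    refine eq_of_natCast_mul_eq_convK ℋ hcomul hconn hβ.map_one
      ((hΓ1 _ G hG).trans hα.1.symm)
      (natCast_mul_eq_convK_of_GammaFormula ℋ hcomul hconn hβ.map_one hG) fun n x hx => ?_
    rw [hαY]
    simp [hY n x hx]

end
end
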